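/- arXiv:0809.4500 — 2 statements merged into one kernel-verified Lean document; each statement's English description precedes it below -/
import Mathlib

section
/- For any two matrices U ∈ ℂ^{m×p} and V ∈ ℂ^{q×m}, the matrix E := U(VU)†V satisfies N(E) = N(V) ⊕ (V*V)†((R(U) + N(V))⊥), where the sum is an (internal) direct sum of subspaces: N(E) = N(V) + (V*V)†((R(U)+N(V))⊥) and N(V) ∩ (V*V)†((R(U)+N(V))⊥) = {0}. Here (V*V)†(S) denotes the image of the subspace S under the linear map given by the matrix (V*V)† and ⊥ denotes orthogonal complement in ℂ^m. -/
open Matrix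

/-- The four Penrose conditions characterizing the Moore-Penrose inverse. -/
def IsMoorePenrose {m n : ℕ} (A : Matrix (Fin m) (Fin n) ℂ)
    (X : Matrix (Fin n) (Fin m) ℂ) : Prop :=
  A * X * A = A ∧ X * A * X = X ∧ (A * X)ᴴ = A * X ∧ (X * A)ᴴ = X * A

/-- The range (column space) of a matrix, as a subspace of Euclidean space. -/
noncomputable def mrange {m n : ℕ} (A : Matrix (Fin m) (Fin n) ℂ) :
    Submodule ℂ (EuclideanSpace ℂ (Fin m)) :=
  LinearMap.range (Matrix.toEuclideanLin A)

/-- The null space of a matrix, as a subspace of Euclidean space. -/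
noncomputable def mker {m n : ℕ} (A : Matrix (Fin m) (Fin n) ℂ) :
    Submodule ℂ (EuclideanSpace ℂ (Fin n)) :=
  LinearMap.ker (Matrix.toEuclideanLin A)

theorem mem_mker_iff {m n : ℕ} (A : Matrix (Fin m) (Fin n) ℂ) (x : EuclideanSpace ℂ (Fin n)) :
    x ∈ mker A ↔ A *ᵥ x.ofLp = 0 := by
  unfold mker
  rw [LinearMap.mem_ker, Matrix.toLpLin_apply, WithLp.toLp_eq_zero]

theorem mrange_orth {m n : ℕ} (A : Matrix (Fin m) (Fin n) ℂ) : (mrange A)ᗮ = mker Aᴴ := by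
  unfold mrange mker
  rw [LinearMap.orthogonal_range, Matrix.toEuclideanLin_conjTranspose_eq_adjoint]

open scoped ComplexOrder in
theorem mker_gram {m n : ℕ} (V : Matrix (Fin m) (Fin n) ℂ) : mker (Vᴴ * V) = mker V := by
  ext x
  rw [mem_mker_iff, mem_mker_iff, Matrix.conjTranspose_mul_self_mulVec_eq_zero]

theorem mker_orth {m n : ℕ} (V : Matrix (Fin m) (Fin n) ℂ) : (mker V)ᗮ = mrange (Vᴴ * V) := by
  have h := mrange_orth (Vᴴ * V)
  rw [(Matrix.isHermitian_conjTranspose_mul_self V).eq, mker_gram] at h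
  rw [← h, Submodule.orthogonal_orthogonal]

theorem mem_mker_E {m p q : ℕ} (U : Matrix (Fin m) (Fin p) ℂ) (V : Matrix (Fin q) (Fin m) ℂ)
    (X : Matrix (Fin p) (Fin q) ℂ) (hX : IsMoorePenrose (V * U) X)
    (x : EuclideanSpace ℂ (Fin m)) :
    x ∈ mker (U * X * V) ↔ Uᴴ *ᵥ ((Vᴴ * V) *ᵥ x.ofLp) = 0 := by
  obtain ⟨h1, h2, h3, -⟩ := hX
  have e1 : Uᴴ * (Vᴴ * V) = Uᴴ * Vᴴ * V * (U * X * V) := by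
    have h : (V * U)ᴴ * (V * U * X) = (V * U)ᴴ := by
      rw [← h3, ← conjTranspose_mul, h1]
    rw [conjTranspose_mul] at h
    calc Uᴴ * (Vᴴ * V) = (Uᴴ * Vᴴ) * V := by simp only [Matrix.mul_assoc]
      _ = (Uᴴ * Vᴴ * (V * U * X)) * V := by rw [h]
      _ = _ := by simp only [Matrix.mul_assoc]
  have e2 : U * X * V = U * X * Xᴴ * (Uᴴ * (Vᴴ * V)) := by
    have h : V * U * X = Xᴴ * (Uᴴ * Vᴴ) := by
      rw [← conjTranspose_mul V U, ← conjTranspose_mul, h3]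
    calc U * X * V = U * (X * (V * U) * X) * V := by rw [h2]
      _ = U * X * (V * U * X) * V := by simp only [Matrix.mul_assoc]
      _ = _ := by rw [h]; simp only [Matrix.mul_assoc]
  rw [mem_mker_iff, mulVec_mulVec]
  constructor
  · intro h
    rw [e1, ← mulVec_mulVec, h, mulVec_zero]
  · intro h
    rw [e2, ← mulVec_mulVec, h, mulVec_zero]

theorem mem_target {m p q : ℕ} (U : Matrix (Fin m) (Fin p) ℂ) (V : Matrix (Fin q) (Fin m) ℂ)
    (y : EuclideanSpace ℂ (Fin m)) :
    y ∈ (mrange U ⊔ mker V)ᗮ ↔ Uᴴ *ᵥ y.ofLp = 0 ∧ ∃ w, (Vᴴ * V) *ᵥ w = y.ofLp := by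
  rw [← Submodule.inf_orthogonal, Submodule.mem_inf, mrange_orth, mker_orth, mem_mker_iff]
  unfold mrange
  rw [LinearMap.mem_range]
  refine and_congr_right fun _ => ⟨?_, ?_⟩
  · rintro ⟨w, rfl⟩
    exact ⟨w.ofLp, rfl⟩
  · rintro ⟨w, h⟩
    exact ⟨WithLp.toLp 2 w, by ext i; exact congrFun h i⟩

/-- For any matrices `U ∈ ℂ^{m×p}` and `V ∈ ℂ^{q×m}`, the matrix
`E = U (VU)† V` satisfies `N(E) = N(V) ⊕ (V*V)†((R(U) + N(V))⊥)` (an internal direct sum). -/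
theorem stmt10 {m p q : ℕ} (U : Matrix (Fin m) (Fin p) ℂ) (V : Matrix (Fin q) (Fin m) ℂ)
    (X : Matrix (Fin p) (Fin q) ℂ) (hX : IsMoorePenrose (V * U) X)
    (W : Matrix (Fin m) (Fin m) ℂ) (hW : IsMoorePenrose (Vᴴ * V) W) :
    mker (U * X * V) =
        mker V ⊔ Submodule.map (Matrix.toEuclideanLin W) ((mrange U ⊔ mker V)ᗮ) ∧
      mker V ⊓ Submodule.map (Matrix.toEuclideanLin W) ((mrange U ⊔ mker V)ᗮ) = ⊥ := by
  obtain ⟨g1, -, -, -⟩ := hW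
  have key : ∀ w, (Vᴴ * V) *ᵥ (W *ᵥ ((Vᴴ * V) *ᵥ w)) = (Vᴴ * V) *ᵥ w := by
    intro w
    rw [mulVec_mulVec, mulVec_mulVec, g1]
  constructor
  · apply le_antisymm
    · intro x hx
      rw [mem_mker_E U V X hX] at hx
      rw [Submodule.mem_sup]
      refine ⟨x - WithLp.toLp 2 (W *ᵥ ((Vᴴ * V) *ᵥ x.ofLp)), ?_,
        WithLp.toLp 2 (W *ᵥ ((Vᴴ * V) *ᵥ x.ofLp)), ?_, sub_add_cancel _ _⟩
      · rw [← mker_gram, mem_mker_iff, WithLp.ofLp_sub, mulVec_sub, key, sub_self]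
      · exact ⟨WithLp.toLp 2 ((Vᴴ * V) *ᵥ x.ofLp), (mem_target U V _).2 ⟨hx, _, rfl⟩, rfl⟩
    · apply sup_le
      · intro x hx
        rw [← mker_gram, mem_mker_iff] at hx
        rw [mem_mker_E U V X hX, hx, mulVec_zero]
      · rintro _ ⟨y, hy, rfl⟩
        obtain ⟨hy, w, hw⟩ := (mem_target U V y).1 hy
        rw [mem_mker_E U V X hX, Matrix.toLpLin_apply, ← hw, key, hw, hy]
  · rw [eq_bot_iff]
    rintro _ ⟨hx, y, hy, rfl⟩
    obtain ⟨-, w, hw⟩ := (mem_target U V y).1 hy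
    have hx' := (mem_mker_iff _ _).1 ((mker_gram V).symm ▸ hx)
    rw [Matrix.toLpLin_apply, ← hw, key] at hx'
    rw [Submodule.mem_bot, Matrix.toLpLin_apply, ← hw, hx', mulVec_zero, WithLp.toLp_zero]
end

section
/- Let A₁ ∈ ℂ^{m×n} with rank(A₁) = n, A₂ ∈ ℂ^{k×n} with rank(A₂) = k ≥ 1, and let D₂ ∈ ℂ^{n×s} be any matrix with R(D₂) = N(A₂). Then the matrix D₂(A₁D₂)†A₁ is idempotent with range N(A₂) and null space equal to the image of R(A₂*) under the linear map given by (A₁*A₁)⁻¹; in particular this projector does not depend on the choice of D₂. -/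
open Matrix

theorem aux_mul {a b c : ℕ} (A : Matrix (Fin a) (Fin b) ℂ) (B : Matrix (Fin b) (Fin c) ℂ)
    (x : EuclideanSpace ℂ (Fin c)) :
    Matrix.toEuclideanLin (A * B) x = Matrix.toEuclideanLin A (Matrix.toEuclideanLin B x) := by
  simp [Matrix.toLpLin_apply, Matrix.mulVec_mulVec]

open scoped ComplexOrder in
theorem aux_gram {m n : ℕ} (A : Matrix (Fin m) (Fin n) ℂ) (hA : A.rank = n) :
    IsUnit (Aᴴ * A).det := by
  rw [← Matrix.isUnit_iff_isUnit_det]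
  have h : LinearMap.range (Aᴴ * A).mulVecLin = ⊤ := by
    apply Submodule.eq_top_of_finrank_eq
    have := Matrix.rank_conjTranspose_mul_self A
    rw [Matrix.rank] at this
    rw [this, hA]; simp
  rw [← Matrix.mulVec_surjective_iff_isUnit]
  exact LinearMap.range_eq_top.mp h

theorem aux_ker {n k s : ℕ} (A : Matrix (Fin k) (Fin n) ℂ) (D : Matrix (Fin n) (Fin s) ℂ)
    (h : mrange D = mker A) : mker Dᴴ = mrange Aᴴ := by
  unfold mker mrange at *
  rw [Matrix.toEuclideanLin_conjTranspose_eq_adjoint,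
    Matrix.toEuclideanLin_conjTranspose_eq_adjoint, ← LinearMap.orthogonal_range, h,
    LinearMap.orthogonal_ker]

theorem aux_main {m n k s : ℕ}
    (A₁ : Matrix (Fin m) (Fin n) ℂ) (hA₁ : A₁.rank = n)
    (A₂ : Matrix (Fin k) (Fin n) ℂ)
    (D : Matrix (Fin n) (Fin s) ℂ) (hD : mrange D = mker A₂)
    (X : Matrix (Fin s) (Fin m) ℂ) (hX : IsMoorePenrose (A₁ * D) X) :
    (D * X * A₁) * (D * X * A₁) = D * X * A₁ ∧
      mrange (D * X * A₁) = mker A₂ ∧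
        mker (D * X * A₁) =
          Submodule.map (Matrix.toEuclideanLin (A₁ᴴ * A₁)⁻¹) (mrange A₂ᴴ) := by
  have hu := aux_gram A₁ hA₁
  obtain ⟨h1, h2, h3, h4⟩ := hX
  have canc : ∀ {c : ℕ} (B C : Matrix (Fin n) (Fin c) ℂ), A₁ * B = A₁ * C → B = C := by
    intro c B C h
    have h' : (A₁ᴴ * A₁)⁻¹ * ((A₁ᴴ * A₁) * B) = (A₁ᴴ * A₁)⁻¹ * ((A₁ᴴ * A₁) * C) := by
      rw [Matrix.mul_assoc A₁ᴴ, Matrix.mul_assoc A₁ᴴ, h]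
    rwa [Matrix.nonsing_inv_mul_cancel_left _ _ hu,
      Matrix.nonsing_inv_mul_cancel_left _ _ hu] at h'
  have hPD : D * X * A₁ * D = D := by
    apply canc
    simpa only [Matrix.mul_assoc] using h1
  refine ⟨?_, ?_, ?_⟩
  · calc D * X * A₁ * (D * X * A₁) = (D * X * A₁ * D) * X * A₁ := by
          simp only [Matrix.mul_assoc]
      _ = _ := by rw [hPD]
  · rw [← hD]
    apply le_antisymm
    · rintro _ ⟨x, rfl⟩
      exact ⟨Matrix.toEuclideanLin (X * A₁) x, by rw [← aux_mul, Matrix.mul_assoc]⟩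
    · rintro _ ⟨x, rfl⟩
      exact ⟨Matrix.toEuclideanLin D x, by rw [← aux_mul, hPD]⟩
  · rw [← aux_ker A₂ D hD]
    -- two matrix identities relating `P` and `Dᴴ G`
    have e1 : Dᴴ * (A₁ᴴ * A₁) = (Dᴴ * (A₁ᴴ * A₁)) * (D * X * A₁) := by
      have := congrArg Matrix.conjTranspose h1
      rw [Matrix.conjTranspose_mul, h3, Matrix.conjTranspose_mul] at this
      calc Dᴴ * (A₁ᴴ * A₁) = (Dᴴ * A₁ᴴ) * A₁ := by simp only [Matrix.mul_assoc]
        _ = (Dᴴ * A₁ᴴ * (A₁ * D * X)) * A₁ := by rw [this]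
        _ = _ := by simp only [Matrix.mul_assoc]
    have e2 : D * X * A₁ = ((A₁ᴴ * A₁)⁻¹ * A₁ᴴ * Xᴴ) * (Dᴴ * (A₁ᴴ * A₁)) := by
      rw [Matrix.conjTranspose_mul, Matrix.conjTranspose_mul] at h3
      calc D * X * A₁ = (A₁ᴴ * A₁)⁻¹ * ((A₁ᴴ * A₁) * (D * X * A₁)) :=
            (Matrix.nonsing_inv_mul_cancel_left _ _ hu).symm
        _ = (A₁ᴴ * A₁)⁻¹ * (A₁ᴴ * ((A₁ * D * X) * A₁)) := by simp only [Matrix.mul_assoc]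
        _ = _ := by rw [← h3]; simp only [Matrix.mul_assoc]
    ext x
    constructor
    · intro hx
      have hx' : Matrix.toEuclideanLin (D * X * A₁) x = 0 := hx
      refine ⟨Matrix.toEuclideanLin (A₁ᴴ * A₁) x, ?_, ?_⟩
      · change Matrix.toEuclideanLin Dᴴ _ = 0
        rw [← aux_mul, e1, aux_mul, hx', map_zero]
      · rw [← aux_mul, Matrix.nonsing_inv_mul _ hu]; simp
    · rintro ⟨y, hy, rfl⟩
      have hy' : Matrix.toEuclideanLin Dᴴ y = 0 := hy
      change Matrix.toEuclideanLin (D * X * A₁) _ = 0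
      rw [e2, aux_mul, ← aux_mul _ _ y, Matrix.mul_assoc Dᴴ, Matrix.mul_nonsing_inv _ hu,
        Matrix.mul_one, hy', map_zero]

theorem aux_proj {n : ℕ} (P Q : Matrix (Fin n) (Fin n) ℂ) (hP : P * P = P) (hQ : Q * Q = Q)
    (hr : mrange P = mrange Q) (hk : mker P = mker Q) : P = Q := by
  apply Matrix.toEuclideanLin.injective
  ext1 x
  have a : Matrix.toEuclideanLin P (x - Matrix.toEuclideanLin Q x) = 0 := by
    have : x - Matrix.toEuclideanLin Q x ∈ mker Q := by
      change Matrix.toEuclideanLin Q _ = 0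
      rw [map_sub, ← aux_mul, hQ, sub_self]
    rw [← hk] at this
    exact this
  have b : Matrix.toEuclideanLin Q x ∈ mrange Q := ⟨x, rfl⟩
  rw [← hr] at b
  obtain ⟨y, hy⟩ := b
  rw [map_sub, sub_eq_zero] at a
  rw [a, ← hy, ← aux_mul, hP]

/-- If `rank(A₁) = n` and `R(D₂) = N(A₂)`, then `D₂(A₁D₂)†A₁` is idempotent
with range `N(A₂)` and null space `(A₁*A₁)⁻¹ R(A₂*)`; in particular it does not depend on
the choice of `D₂`. -/
theorem stmt15 {m n k s : ℕ}
    (A₁ : Matrix (Fin m) (Fin n) ℂ) (hA₁ : A₁.rank = n)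
    (A₂ : Matrix (Fin k) (Fin n) ℂ) (hk : 1 ≤ k) (hA₂ : A₂.rank = k)
    (D₂ : Matrix (Fin n) (Fin s) ℂ) (hD₂ : mrange D₂ = mker A₂)
    (X : Matrix (Fin s) (Fin m) ℂ) (hX : IsMoorePenrose (A₁ * D₂) X) :
    (D₂ * X * A₁) * (D₂ * X * A₁) = D₂ * X * A₁ ∧
      mrange (D₂ * X * A₁) = mker A₂ ∧
        mker (D₂ * X * A₁) =
          Submodule.map (Matrix.toEuclideanLin (A₁ᴴ * A₁)⁻¹) (mrange A₂ᴴ) ∧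
          ∀ (s' : ℕ) (D₂' : Matrix (Fin n) (Fin s') ℂ), mrange D₂' = mker A₂ →
            ∀ X' : Matrix (Fin s') (Fin m) ℂ, IsMoorePenrose (A₁ * D₂') X' →
              D₂' * X' * A₁ = D₂ * X * A₁ := by
  obtain ⟨a, b, c⟩ := aux_main A₁ hA₁ A₂ D₂ hD₂ X hX
  refine ⟨a, b, c, ?_⟩
  intro s' D' hD' X' hX'
  obtain ⟨a', b', c'⟩ := aux_main A₁ hA₁ A₂ D' hD' X' hX'
  exact aux_proj _ _ a' a (b'.trans b.symm) (c'.trans c.symm)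
end
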